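/- Let y₁ be a solution of equation (2.1) on [t₀, T] with y₁(t₀) ≤ 0. Assume: (i) a(t) < 0 for almost every t ∈ [t₀, T] and b²/a is Lebesgue integrable on [t₀, T]; (ii) there exists γ₁ ∈ [y₁(t₀), −y₁(t₀)] such that for all t ∈ [t₀, T], γ₁ − y₁(t₀) + ∫_{t₀}^{t} exp(∫_{t₀}^{τ} [c(s) − b(s)²/a(s)] ds)·[(a₁(τ) − a(τ))y₁(τ)³ + (b₁(τ) − b(τ))y₁(τ)² + (c₁(τ) − c(τ))y₁(τ) + d₁(τ) − d(τ)] dτ ≥ 0; (iii) there exists γ₂ ∈ [γ₁, −y₁(t₀)] such that for all t ∈ [t₀, T], γ₂ + y₁(t₀) + ∫_{t₀}^{t} exp(∫_{t₀}^{τ} [c(s) − b(s)²/a(s)] ds)·[(a(τ) − a₁(τ))y₁(τ)³ − (b₁(τ) + b(τ))y₁(τ)² + (c(τ) − c₁(τ))y₁(τ) − d₁(τ) − d(τ)] dτ ≤ 0. Then the Abel equation (1.1) has a closed solution on [t₀, T]. -/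

import Mathlib

open Set MeasureTheory intervalIntegral

/-- The right-hand side `-(a y³ + b y² + c y + d)` of the Abel equation (1.1). -/
noncomputable def abelRHS (a b c d y : ℝ → ℝ) (t : ℝ) : ℝ :=
  -(a t * y t ^ 3 + b t * y t ^ 2 + c t * y t + d t)

/-- `y` is a solution of the Abel equation `y' + a y³ + b y² + c y + d = 0` on the set `S`. -/
def IsAbelSolOn (a b c d y : ℝ → ℝ) (S : Set ℝ) : Prop :=
  ∀ t ∈ S, HasDerivWithinAt y (abelRHS a b c d y t) S t

/-- The set of real points of the interval `[t₀, τ)`, `τ` an extended real. -/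
def eIco (t₀ : ℝ) (τ : EReal) : Set ℝ := {t : ℝ | t₀ ≤ t ∧ (t : EReal) < τ}

/-- A solution `y` of the Abel equation on `[t₀, t₁) ⊆ [t₀, τ₀)` is noncontinuable if it
cannot be extended to the right as a solution on a larger subinterval of `[t₀, τ₀)`. -/
def Noncontinuable (a b c d : ℝ → ℝ) (t₀ : ℝ) (τ₀ t₁ : EReal) (y : ℝ → ℝ) : Prop :=
  ¬ ∃ (t₂ : EReal) (z : ℝ → ℝ), t₁ < t₂ ∧ t₂ ≤ τ₀ ∧
      IsAbelSolOn a b c d z (eIco t₀ t₂) ∧ EqOn z y (eIco t₀ t₁)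


lemma exists_closed_of_flow {F : ℝ → ℝ → ℝ} {t₀ T : ℝ} (hT : t₀ < T) {L K R : NNReal}
    (hlip : ∀ t ∈ Icc t₀ T, LipschitzWith K (F t))
    (hcont : ∀ x, ContinuousOn (fun t => F t x) (Icc t₀ T))
    (hbd : ∀ t ∈ Icc t₀ T, ∀ x, ‖F t x‖ ≤ L)
    (h1 : ∀ y : ℝ → ℝ, (∀ t ∈ Icc t₀ T, HasDerivWithinAt y (F t (y t)) (Icc t₀ T) t) →
      y t₀ = R → (R : ℝ) ≤ y T)
    (h2 : ∀ y : ℝ → ℝ, (∀ t ∈ Icc t₀ T, HasDerivWithinAt y (F t (y t)) (Icc t₀ T) t) →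
      y t₀ = -R → y T ≤ -(R : ℝ)) :
    ∃ y : ℝ → ℝ, (∀ t ∈ Icc t₀ T, HasDerivWithinAt y (F t (y t)) (Icc t₀ T) t) ∧
      y t₀ = y T := by
  have hPL : IsPicardLindelof F (tmin := t₀) (tmax := T) ⟨t₀, left_mem_Icc.2 hT.le⟩ (0 : ℝ)
      (R + L * (T - t₀).toNNReal) R L K := by
    refine ⟨fun t ht => (hlip t ht).lipschitzOnWith, fun x _ => hcont x,
      fun t ht x _ => hbd t ht x, ?_⟩
    simp only [sub_self, NNReal.coe_add, NNReal.coe_mul]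
    rw [Real.coe_toNNReal _ (by linarith)]
    rw [max_eq_left (by linarith)]
    linarith
  obtain ⟨α, hα, L', hL⟩ :=
    hPL.exists_forall_mem_closedBall_eq_hasDerivWithinAt_lipschitzOnWith
  have hcT : ContinuousOn (fun x => α x T - x) (Icc (-(R : ℝ)) R) := by
    have := (hL T (right_mem_Icc.2 hT.le)).continuousOn
    rw [Real.closedBall_eq_Icc] at this
    simp only [zero_sub, zero_add] at this
    exact this.sub continuousOn_id
  have hRR : -(R : ℝ) ≤ R := by have := R.2; linarith [NNReal.coe_nonneg R]
  have hmem : ∀ x ∈ Icc (-(R : ℝ)) R, x ∈ Metric.closedBall (0 : ℝ) R := by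
    intro x hx
    rw [Real.closedBall_eq_Icc]; simpa using hx
  have hl := hα _ (hmem _ (left_mem_Icc.2 hRR))
  have hr := hα _ (hmem _ (right_mem_Icc.2 hRR))
  have e1 := h1 _ hr.2 hr.1
  have e2 := h2 _ hl.2 hl.1
  have := intermediate_value_Icc hRR hcT
  obtain ⟨x, hx, hx0⟩ := this (show (0 : ℝ) ∈ _ from ⟨by linarith, by linarith⟩)
  refine ⟨α x, (hα x (hmem x hx)).2, ?_⟩
  have h3 : α x t₀ = x := (hα x (hmem x hx)).1
  simp only at hx0
  linarith

/-- truncation to `[-N, N]` -/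
noncomputable def clampN (N y : ℝ) : ℝ := max (-N) (min N y)

lemma clampN_lip (N : ℝ) : LipschitzWith 1 (clampN N) :=
  (LipschitzWith.id.const_min N).const_max (-N)

lemma clampN_cont (N : ℝ) : Continuous (clampN N) := (clampN_lip N).continuous

lemma clampN_abs {N : ℝ} (hN : 0 ≤ N) (y : ℝ) : |clampN N y| ≤ N := by
  rw [abs_le]
  exact ⟨le_max_left _ _, max_le (by linarith) (min_le_left _ _)⟩

lemma clampN_of_abs_le {N y : ℝ} (h : |y| ≤ N) : clampN N y = y := by
  rw [abs_le] at h
  rw [clampN, min_eq_right h.2, max_eq_right h.1]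

lemma clampN_of_ge {N y : ℝ} (hN : 0 ≤ N) (h : N ≤ y) : clampN N y = N := by
  rw [clampN, min_eq_left h, max_eq_right (by linarith)]

lemma clampN_of_le {N y : ℝ} (hN : 0 ≤ N) (h : y ≤ -N) : clampN N y = -N := by
  rw [clampN, min_eq_right (by linarith), max_eq_left h]

lemma clampN_neg (N y : ℝ) (hN : 0 ≤ N) : clampN N (-y) = - clampN N y := by
  simp only [clampN]
  rcases le_total N y with h | h <;> rcases le_total (-N) y with h' | h'
  all_goals
    first
    | rw [min_eq_left h]
    | rw [min_eq_right h]
    rcases le_total N (-y) with h2 | h2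
    all_goals
      first
      | rw [min_eq_left h2]
      | rw [min_eq_right h2]
      simp only [max_def]
      split_ifs <;> linarith

lemma clampN_abs_ge {N M y : ℝ} (hM : 0 ≤ M) (hMN : M ≤ N) (h : M ≤ |y|) :
    M ≤ |clampN N y| := by
  by_cases h1 : |y| ≤ N
  · rwa [clampN_of_abs_le h1]
  · push Not at h1
    rcases le_total 0 y with h2 | h2
    · rw [abs_of_nonneg h2] at h1
      rw [clampN_of_ge (by linarith) h1.le, abs_of_nonneg (by linarith)]; exact hMN
    · rw [abs_of_nonpos h2] at h1
      rw [clampN_of_le (by linarith) (by linarith), abs_neg, abs_of_nonneg (by linarith)]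
      exact hMN

/-- derivative of the Lyapunov function -/
noncomputable def lyapD (N u : ℝ) : ℝ := clampN N u / (1 + clampN N u ^ 2)

noncomputable def lyap (N y : ℝ) : ℝ := ∫ u in (0 : ℝ)..y, lyapD N u

lemma lyapD_cont (N : ℝ) : Continuous (lyapD N) := by
  unfold lyapD
  exact (clampN_cont N).div (by have := clampN_cont N; fun_prop) (fun x => by positivity)

lemma lyap_hasDeriv (N y : ℝ) : HasDerivAt (lyap N) (lyapD N y) y :=
  intervalIntegral.integral_hasDerivAt_right ((lyapD_cont N).intervalIntegrable _ _)
    ((lyapD_cont N).stronglyMeasurableAtFilter _ _) (lyapD_cont N).continuousAt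

lemma lyap_abs {N : ℝ} (hN : 0 ≤ N) (y : ℝ) : lyap N |y| = lyap N y := by
  rcases abs_choice y with h | h
  · rw [h]
  · rw [h]
    unfold lyap
    have : ∀ u, lyapD N (-u) = - lyapD N u := by
      intro u
      unfold lyapD
      rw [clampN_neg N u hN]; ring
    have h2 := intervalIntegral.integral_comp_neg (a := 0) (b := y) (lyapD N)
    simp only [this, intervalIntegral.integral_neg, neg_zero] at h2
    rw [intervalIntegral.integral_symm, ← h2, neg_neg]

lemma lyap_mono {N : ℝ} (hN : 0 ≤ N) : MonotoneOn (lyap N) (Ici 0) := by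
  refine monotoneOn_of_deriv_nonneg (convex_Ici 0)
    (fun x _ => (lyap_hasDeriv N x).continuousAt.continuousWithinAt)
    (fun x _ => (lyap_hasDeriv N x).differentiableAt.differentiableWithinAt) ?_
  intro x hx
  rw [interior_Ici] at hx
  rw [(lyap_hasDeriv N x).deriv]
  unfold lyapD
  refine div_nonneg ?_ (by positivity)
  exact le_max_of_le_right (le_min hN (le_of_lt hx))

lemma lyap_eq {N x : ℝ} (hx : 0 ≤ x) (hN : x ≤ N) : lyap N x = Real.log (1 + x ^ 2) / 2 := by
  have h : ∀ u ∈ uIcc 0 x, HasDerivAt (fun u : ℝ => Real.log (1 + u ^ 2) / 2) (lyapD N u) u := by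
    intro u hu
    rw [uIcc_of_le hx] at hu
    have hp : (1 + u ^ 2) ≠ 0 := by positivity
    have h1 : HasDerivAt (fun u : ℝ => 1 + u ^ 2) (2 * u) u := by
      simpa using (hasDerivAt_pow 2 u).const_add 1
    have h2 := (h1.log hp).div_const 2
    refine h2.congr_deriv ?_
    unfold lyapD
    rw [clampN_of_abs_le (by rw [abs_of_nonneg hu.1]; linarith [hu.2])]
    field_simp
  unfold lyap
  rw [intervalIntegral.integral_eq_sub_of_hasDerivAt h ((lyapD_cont N).intervalIntegrable _ _)]
  simp

/-- pointwise dissipation estimate -/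
lemma pointwise_est {a b c d z : ℝ} (ha : a < 0) :
    -(a / 2) * (z ^ 4 / (1 + z ^ 2)) - (-(b ^ 2 / a) / 2 + |c| + |d|) ≤
      z / (1 + z ^ 2) * (-(a * z ^ 3 + b * z ^ 2 + c * z + d)) := by
  have hp : 0 < 1 + z ^ 2 := by positivity
  set k := -(b ^ 2 / a) / 2 with hk
  have hk0 : 0 ≤ k := by
    have : b ^ 2 / a ≤ 0 := div_nonpos_of_nonneg_of_nonpos (by positivity) ha.le
    rw [hk]; linarith
  have hsq : 0 ≤ -(a / 2) * z ^ 4 - b * z ^ 3 + k * z ^ 2 := by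
    have : -(a / 2) * z ^ 4 - b * z ^ 3 + k * z ^ 2 = (z ^ 2 * (a * z + b) ^ 2) / (2 * (-a)) := by
      rw [hk]; field_simp [ha.ne]; ring
    rw [this]
    exact div_nonneg (by positivity) (by linarith)
  have hcz : c * z ^ 2 ≤ |c| * z ^ 2 := mul_le_mul_of_nonneg_right (le_abs_self c) (by positivity)
  have hdz : d * z ≤ |d| * (1 + z ^ 2) := by
    have h1 : d * z ≤ |d| * |z| := by rw [← abs_mul]; exact le_abs_self _
    have h2 : |z| ≤ 1 + z ^ 2 := by rw [← sq_abs]; nlinarith [sq_nonneg (|z| - 1), abs_nonneg z]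
    exact h1.trans (mul_le_mul_of_nonneg_left h2 (abs_nonneg d))
  have e : -(a / 2) * (z ^ 4 / (1 + z ^ 2)) - (k + |c| + |d|) =
    (-(a / 2) * z ^ 4 - (k + |c| + |d|) * (1 + z ^ 2)) / (1 + z ^ 2) := by field_simp
  rw [e, div_mul_eq_mul_div]
  refine div_le_div_of_nonneg_right ?_ hp.le
  nlinarith [abs_nonneg c]

section core
variable {t₀ T : ℝ} {a b c d : ℝ → ℝ}

lemma lower_est (hT : t₀ < T)
    (ha : ContinuousOn a (Icc t₀ T)) (hb : ContinuousOn b (Icc t₀ T))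
    (hc : ContinuousOn c (Icc t₀ T)) (hd : ContinuousOn d (Icc t₀ T))
    (haneg : ∀ᵐ t ∂(volume.restrict (Icc t₀ T)), a t < 0)
    (hint : IntegrableOn (fun t => b t ^ 2 / a t) (Icc t₀ T)) :
    ∃ K : ℝ, 0 ≤ K ∧ ∃ A : ℝ, 0 < A ∧
      (∀ z : ℝ → ℝ, ContinuousOn z (Icc t₀ T) → ∀ s t, t₀ ≤ s → s ≤ t → t ≤ T →
        -K ≤ ∫ τ in s..t, z τ / (1 + z τ ^ 2) *
          (-(a τ * z τ ^ 3 + b τ * z τ ^ 2 + c τ * z τ + d τ))) ∧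
      (∀ z : ℝ → ℝ, ContinuousOn z (Icc t₀ T) → ∀ M : ℝ, 1 ≤ M →
        (∀ t ∈ Icc t₀ T, M ≤ |z t|) →
        M * A - K ≤ ∫ τ in t₀..T, z τ / (1 + z τ ^ 2) *
          (-(a τ * z τ ^ 3 + b τ * z τ ^ 2 + c τ * z τ + d τ))) := by
  set k : ℝ → ℝ := fun t => -(b t ^ 2 / a t) / 2 + |c t| + |d t| with hk
  have hkint : IntegrableOn k (Icc t₀ T) := by
    have h1 : IntegrableOn (fun t => |c t|) (Icc t₀ T) := hc.abs.integrableOn_Icc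
    have h2 : IntegrableOn (fun t => |d t|) (Icc t₀ T) := hd.abs.integrableOn_Icc
    have h3 : IntegrableOn (fun t => -(b t ^ 2 / a t) / 2) (Icc t₀ T) := hint.neg.div_const 2
    exact (h3.add h1).add h2
  have hk0 : 0 ≤ᵐ[volume.restrict (Icc t₀ T)] k := by
    filter_upwards [haneg] with t ht
    have : b t ^ 2 / a t ≤ 0 := div_nonpos_of_nonneg_of_nonpos (by positivity) ht.le
    have h1 := abs_nonneg (c t)
    have h2 := abs_nonneg (d t)
    simp only [hk, Pi.zero_apply]
    linarith
  have hkI : IntervalIntegrable k volume t₀ T :=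
    (intervalIntegrable_iff_integrableOn_Icc_of_le hT.le).2 hkint
  have haI : IntegrableOn a (Icc t₀ T) := ha.integrableOn_Icc
  have hApos : 0 < ∫ t in t₀..T, -a t := by
    rw [intervalIntegral.integral_of_le hT.le, ← integral_Icc_eq_integral_Ioc]
    have hnn : 0 ≤ᵐ[volume.restrict (Icc t₀ T)] (fun t => -a t) := by
      filter_upwards [haneg] with t ht
      simp only [Pi.zero_apply]; linarith
    refine lt_of_le_of_ne (integral_nonneg_of_ae hnn) (fun h => ?_)
    have h2 := (integral_eq_zero_iff_of_nonneg_ae hnn haI.neg).1 h.symm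
    have h3 : ∀ᵐ t ∂(volume.restrict (Icc t₀ T)), False := by
      filter_upwards [haneg, h2] with t ht ht2
      simp only [Pi.zero_apply] at ht2; linarith
    rw [Filter.eventually_false_iff_eq_bot, ae_eq_bot, Measure.restrict_eq_zero,
      Real.volume_Icc] at h3
    simp at h3
    linarith
  have hGc : ∀ z : ℝ → ℝ, ContinuousOn z (Icc t₀ T) →
      ContinuousOn (fun τ => z τ / (1 + z τ ^ 2) *
          (-(a τ * z τ ^ 3 + b τ * z τ ^ 2 + c τ * z τ + d τ))) (Icc t₀ T) := by
    intro z hz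
    have h1 : ContinuousOn (fun τ => z τ / (1 + z τ ^ 2)) (Icc t₀ T) :=
      hz.div (by fun_prop) (fun x _ => by positivity)
    fun_prop
  refine ⟨∫ t in t₀..T, k t, ?_, (∫ t in t₀..T, -a t) / 4, by linarith, ?_, ?_⟩
  · exact intervalIntegral.integral_nonneg_of_ae_restrict hT.le hk0
  · intro z hz s t hs hst ht
    have hsub : Icc s t ⊆ Icc t₀ T := Icc_subset_Icc hs ht
    have hkI' : IntervalIntegrable k volume s t :=
      (intervalIntegrable_iff_integrableOn_Icc_of_le hst).2 (hkint.mono_set hsub)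
    have h1 : ∫ τ in s..t, k τ ≤ ∫ t in t₀..T, k t :=
      intervalIntegral.integral_mono_interval hs hst ht
        (ae_restrict_of_ae_restrict_of_subset Ioc_subset_Icc_self hk0) hkI
    have h2 : ∫ τ in s..t, -k τ ≤ ∫ τ in s..t, z τ / (1 + z τ ^ 2) *
          (-(a τ * z τ ^ 3 + b τ * z τ ^ 2 + c τ * z τ + d τ)) := by
      refine intervalIntegral.integral_mono_ae_restrict hst hkI'.neg
        (((hGc z hz).mono hsub).intervalIntegrable_of_Icc hst) ?_
      filter_upwards [ae_restrict_of_ae_restrict_of_subset hsub haneg] with τ hτ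
      have h3 := pointwise_est (b := b τ) (c := c τ) (d := d τ) (z := z τ) hτ
      have h4 : 0 ≤ -(a τ / 2) * (z τ ^ 4 / (1 + z τ ^ 2)) :=
        mul_nonneg (by linarith) (by positivity)
      simp only [hk]
      linarith
    rw [intervalIntegral.integral_neg] at h2
    linarith
  · intro z hz M hM hzM
    have hI1 : IntervalIntegrable (fun t => M / 4 * -a t) volume t₀ T :=
      (ha.neg.intervalIntegrable_of_Icc hT.le).const_mul _
    have h2 : ∫ τ in t₀..T, (M / 4 * -a τ - k τ) ≤ ∫ τ in t₀..T, z τ / (1 + z τ ^ 2) *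
          (-(a τ * z τ ^ 3 + b τ * z τ ^ 2 + c τ * z τ + d τ)) := by
      refine intervalIntegral.integral_mono_ae_restrict hT.le (hI1.sub hkI)
        ((hGc z hz).intervalIntegrable_of_Icc hT.le) ?_
      filter_upwards [haneg, ae_restrict_mem measurableSet_Icc] with τ hτ hmem
      have h3 := pointwise_est (b := b τ) (c := c τ) (d := d τ) (z := z τ) hτ
      have hz2 : M ≤ z τ ^ 2 := by
        rw [← sq_abs]
        nlinarith [hzM τ hmem]
      have h5 : M / 2 ≤ z τ ^ 4 / (1 + z τ ^ 2) := by
        rw [le_div_iff₀ (by positivity)]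
        nlinarith
      have h4 : -(a τ / 2) * (M / 2) ≤ -(a τ / 2) * (z τ ^ 4 / (1 + z τ ^ 2)) :=
        mul_le_mul_of_nonneg_left h5 (by linarith)
      simp only [hk]
      linarith
    rw [intervalIntegral.integral_sub hI1 hkI, intervalIntegral.integral_const_mul] at h2
    linarith

lemma trunc_bounds (ha : ContinuousOn a (Icc t₀ T)) (hb : ContinuousOn b (Icc t₀ T))
    (hc : ContinuousOn c (Icc t₀ T)) (hd : ContinuousOn d (Icc t₀ T)) {N : ℝ} (hN : 0 ≤ N) :
    ∃ L K : NNReal,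
      (∀ t ∈ Icc t₀ T, LipschitzWith K (fun y => -(a t * clampN N y ^ 3 + b t * clampN N y ^ 2 +
        c t * clampN N y + d t))) ∧
      (∀ t ∈ Icc t₀ T, ∀ y, ‖-(a t * clampN N y ^ 3 + b t * clampN N y ^ 2 +
        c t * clampN N y + d t)‖ ≤ L) := by
  obtain ⟨Ca, hCa⟩ := isCompact_Icc.exists_bound_of_continuousOn ha
  obtain ⟨Cb, hCb⟩ := isCompact_Icc.exists_bound_of_continuousOn hb
  obtain ⟨Cc, hCc⟩ := isCompact_Icc.exists_bound_of_continuousOn hc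
  obtain ⟨Cd, hCd⟩ := isCompact_Icc.exists_bound_of_continuousOn hd
  refine ⟨(Ca * N ^ 3 + Cb * N ^ 2 + Cc * N + Cd).toNNReal,
    (Ca * (3 * N ^ 2) + Cb * (2 * N) + Cc).toNNReal, ?_, ?_⟩
  · intro t ht
    have ha' := hCa t ht
    have hb' := hCb t ht
    have hc' := hCc t ht
    rw [Real.norm_eq_abs] at ha' hb' hc'
    refine LipschitzWith.of_dist_le_mul fun x y => ?_
    rw [Real.dist_eq, Real.dist_eq]
    have hxy : |clampN N x - clampN N y| ≤ |x - y| := by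
      have := (clampN_lip N).dist_le_mul x y
      simpa [Real.dist_eq] using this
    have hx := clampN_abs hN x
    have hy := clampN_abs hN y
    set u := clampN N x
    set v := clampN N y
    have e : -(a t * u ^ 3 + b t * u ^ 2 + c t * u + d t) -
        -(a t * v ^ 3 + b t * v ^ 2 + c t * v + d t) =
        -((a t * (u ^ 2 + u * v + v ^ 2) + b t * (u + v) + c t) * (u - v)) := by ring
    rw [e, abs_neg, abs_mul]
    have h1 : |u ^ 2 + u * v + v ^ 2| ≤ 3 * N ^ 2 := by
      rw [abs_le] at hx hy ⊢
      constructor <;> nlinarith [hx.1, hx.2, hy.1, hy.2]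
    have h2 : |u + v| ≤ 2 * N := (abs_add_le u v).trans (by linarith)
    have h3 : |a t * (u ^ 2 + u * v + v ^ 2) + b t * (u + v) + c t| ≤
        Ca * (3 * N ^ 2) + Cb * (2 * N) + Cc := by
      refine (abs_add_three _ _ _).trans ?_
      rw [abs_mul, abs_mul]
      have := abs_nonneg (a t)
      have := abs_nonneg (b t)
      gcongr
      · linarith
      · linarith
    exact mul_le_mul (h3.trans (Real.le_coe_toNNReal _)) hxy (abs_nonneg _) (NNReal.coe_nonneg _)
  · intro t ht y
    have ha' := hCa t ht
    have hb' := hCb t ht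
    have hc' := hCc t ht
    have hd' := hCd t ht
    refine le_trans ?_ (Real.le_coe_toNNReal _)
    rw [Real.norm_eq_abs] at ha' hb' hc' hd' ⊢
    have hy := clampN_abs hN y
    set v := clampN N y
    rw [abs_neg]
    refine (abs_add_le _ _).trans (add_le_add ((abs_add_three _ _ _).trans ?_) hd')
    rw [abs_mul, abs_mul, abs_mul, abs_pow, abs_pow]
    have := abs_nonneg (a t)
    have := abs_nonneg (b t)
    have := abs_nonneg (c t)
    gcongr <;> linarith

end core

/-- Corollary 5.1: existence of a closed solution of the Abel equation (1.1) on `[t₀, T]`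
by comparison with a solution `y₁` of (2.1) with `y₁ t₀ ≤ 0` (and its reflection `-y₁`),
under `a < 0` a.e., integrability of `b²/a`, and the integral conditions (ii), (iii). -/
theorem stmt_18 (t₀ T : ℝ) (hT : t₀ < T)
    (a b c d a₁ b₁ c₁ d₁ y₁ : ℝ → ℝ)
    (ha : ContinuousOn a (Icc t₀ T)) (hb : ContinuousOn b (Icc t₀ T))
    (hc : ContinuousOn c (Icc t₀ T)) (hd : ContinuousOn d (Icc t₀ T))
    (ha₁ : ContinuousOn a₁ (Icc t₀ T)) (hb₁ : ContinuousOn b₁ (Icc t₀ T))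
    (hc₁ : ContinuousOn c₁ (Icc t₀ T)) (hd₁ : ContinuousOn d₁ (Icc t₀ T))
    (hy₁ : IsAbelSolOn a₁ b₁ c₁ d₁ y₁ (Icc t₀ T))
    (hy₁0 : y₁ t₀ ≤ 0)
    (haneg : ∀ᵐ t ∂(volume.restrict (Icc t₀ T)), a t < 0)
    (hint : IntegrableOn (fun t => b t ^ 2 / a t) (Icc t₀ T))
    (γ₁ : ℝ) (hγ₁ : γ₁ ∈ Icc (y₁ t₀) (-(y₁ t₀)))
    (hii : ∀ t ∈ Icc t₀ T,
      0 ≤ γ₁ - y₁ t₀ + ∫ τ in t₀..t,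
        Real.exp (∫ s in t₀..τ, (c s - b s ^ 2 / a s)) *
          ((a₁ τ - a τ) * y₁ τ ^ 3 + (b₁ τ - b τ) * y₁ τ ^ 2 +
            (c₁ τ - c τ) * y₁ τ + (d₁ τ - d τ)))
    (γ₂ : ℝ) (hγ₂ : γ₂ ∈ Icc γ₁ (-(y₁ t₀)))
    (hiii : ∀ t ∈ Icc t₀ T,
      γ₂ + y₁ t₀ + (∫ τ in t₀..t,
        Real.exp (∫ s in t₀..τ, (c s - b s ^ 2 / a s)) *
          ((a τ - a₁ τ) * y₁ τ ^ 3 - (b₁ τ + b τ) * y₁ τ ^ 2 +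
            (c τ - c₁ τ) * y₁ τ - d₁ τ - d τ)) ≤ 0) :
    ∃ y : ℝ → ℝ, IsAbelSolOn a b c d y (Icc t₀ T) ∧ y t₀ = y T := by
  obtain ⟨K, hK0, A, hA, hlow, hhigh⟩ := lower_est hT ha hb hc hd haneg hint
  obtain ⟨M, hM1, hMA⟩ : ∃ M : ℝ, 1 ≤ M ∧ 0 < M * A - K := by
    refine ⟨max 1 ((K + 1) / A), le_max_left _ _, ?_⟩
    have h := le_max_right 1 ((K + 1) / A)
    rw [div_le_iff₀ hA] at h
    linarith
  obtain ⟨N, hMN, hlog⟩ : ∃ N : ℝ, M ≤ N ∧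
      Real.log (1 + M ^ 2) / 2 + 2 * K < Real.log (1 + N ^ 2) / 2 := by
    have hE : 1 ≤ Real.exp (4 * K + 1) := Real.one_le_exp (by linarith)
    have hsq : Real.sqrt ((1 + M ^ 2) * Real.exp (4 * K + 1)) ^ 2 =
      (1 + M ^ 2) * Real.exp (4 * K + 1) := Real.sq_sqrt (by positivity)
    refine ⟨Real.sqrt ((1 + M ^ 2) * Real.exp (4 * K + 1)), ?_, ?_⟩
    · exact Real.le_sqrt_of_sq_le (by nlinarith [sq_nonneg M])
    · rw [hsq]
      have h1 : Real.log ((1 + M ^ 2) * Real.exp (4 * K + 1)) ≤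
          Real.log (1 + (1 + M ^ 2) * Real.exp (4 * K + 1)) :=
        Real.log_le_log (by positivity) (by linarith)
      rw [Real.log_mul (by positivity) (Real.exp_ne_zero _), Real.log_exp] at h1
      linarith
  have hN0 : 0 ≤ N := by linarith
  obtain ⟨L, Kl, hlip, hbd⟩ := trunc_bounds ha hb hc hd hN0
  set F : ℝ → ℝ → ℝ := fun t y => -(a t * clampN N y ^ 3 + b t * clampN N y ^ 2 +
        c t * clampN N y + d t) with hF
  have hcz : ∀ y : ℝ → ℝ, (∀ t ∈ Icc t₀ T, HasDerivWithinAt y (F t (y t)) (Icc t₀ T) t) →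
      ContinuousOn (fun t => clampN N (y t)) (Icc t₀ T) := fun y hy =>
    (clampN_cont N).comp_continuousOn (fun t ht => (hy t ht).continuousWithinAt)
  -- the Lyapunov function along truncated solutions
  have hW : ∀ y : ℝ → ℝ, (∀ t ∈ Icc t₀ T, HasDerivWithinAt y (F t (y t)) (Icc t₀ T) t) →
      ∀ s t, t₀ ≤ s → s ≤ t → t ≤ T →
      (∫ τ in s..t, clampN N (y τ) / (1 + clampN N (y τ) ^ 2) *
        (-(a τ * clampN N (y τ) ^ 3 + b τ * clampN N (y τ) ^ 2 + c τ * clampN N (y τ) + d τ))) =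
        lyap N (y t) - lyap N (y s) := by
    intro y hy s t hs hst ht
    have hsub : Icc s t ⊆ Icc t₀ T := Icc_subset_Icc hs ht
    have hz := hcz y hy
    have hyc : ContinuousOn y (Icc t₀ T) := fun t ht => (hy t ht).continuousWithinAt
    refine intervalIntegral.integral_eq_sub_of_hasDerivAt_of_le hst
      (f := fun τ => lyap N (y τ)) ?_ ?_ ?_
    · refine ContinuousOn.mono ?_ hsub
      have hlc : Continuous (lyap N) :=
        continuous_iff_continuousAt.2 fun x => (lyap_hasDeriv N x).continuousAt
      exact hlc.comp_continuousOn hyc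
    · intro x hx
      have hx' : x ∈ Icc t₀ T := hsub (Ioo_subset_Icc_self hx)
      have hd1 : HasDerivAt y (F x (y x)) x :=
        (hy x hx').hasDerivAt (Icc_mem_nhds (by linarith [hx.1]) (by linarith [hx.2]))
      exact (lyap_hasDeriv N (y x)).comp x hd1
    · refine ContinuousOn.intervalIntegrable_of_Icc hst (ContinuousOn.mono ?_ hsub)
      have h1 : ContinuousOn (fun τ => clampN N (y τ) / (1 + clampN N (y τ) ^ 2)) (Icc t₀ T) :=
        hz.div (by fun_prop) (fun x _ => by positivity)
      fun_prop
  have hW2 : ∀ y : ℝ → ℝ, (∀ t ∈ Icc t₀ T, HasDerivWithinAt y (F t (y t)) (Icc t₀ T) t) →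
      (∀ t ∈ Icc t₀ T, M ≤ |y t|) → lyap N (y t₀) < lyap N (y T) := by
    intro y hy hyM
    have h1 := hhigh _ (hcz y hy) M hM1
      (fun t ht => clampN_abs_ge (by linarith) hMN (hyM t ht))
    rw [hW y hy t₀ T le_rfl hT.le le_rfl] at h1
    linarith
  have hR0 : 0 ≤ N + L * (T - t₀) :=
    add_nonneg hN0 (mul_nonneg (NNReal.coe_nonneg L) (by linarith))
  have hdrift : ∀ y : ℝ → ℝ, (∀ t ∈ Icc t₀ T, HasDerivWithinAt y (F t (y t)) (Icc t₀ T) t) →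
      ∀ t ∈ Icc t₀ T, |y t - y t₀| ≤ L * (T - t₀) := by
    intro y hy t ht
    have h := norm_image_sub_le_of_norm_deriv_le_segment' hy
      (fun x hx => hbd x (Ico_subset_Icc_self hx) (y x)) t ht
    rw [Real.norm_eq_abs] at h
    exact h.trans (mul_le_mul_of_nonneg_left (by linarith [ht.2]) (NNReal.coe_nonneg L))
  have habs : ∀ y : ℝ → ℝ, (∀ t ∈ Icc t₀ T, HasDerivWithinAt y (F t (y t)) (Icc t₀ T) t) →
      |y t₀| = N + L * (T - t₀) → N + L * (T - t₀) < |y T| := by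
    intro y hy h0
    have h1 := hW2 y hy (fun t ht => by
      have h2 := hdrift y hy t ht
      have h3 := abs_sub_abs_le_abs_sub (y t₀) (y t)
      rw [abs_sub_comm] at h3
      linarith)
    rw [← lyap_abs hN0, h0, ← lyap_abs hN0 (y T)] at h1
    by_contra hcon
    push Not at hcon
    have := lyap_mono hN0 (abs_nonneg (y T)) hR0 hcon
    linarith
  obtain ⟨y, hy, hcl⟩ := exists_closed_of_flow (F := F) hT (L := L) (K := Kl)
    (R := ⟨N + L * (T - t₀), hR0⟩) hlip
    (fun x => by simp only [hF]; fun_prop) hbd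
    (fun y hy h0 => by
      change y t₀ = N + L * (T - t₀) at h0
      change N + L * (T - t₀) ≤ y T
      have h1 := habs y hy (by rw [h0, abs_of_nonneg hR0])
      have h2 := abs_le.1 (hdrift y hy T (right_mem_Icc.2 hT.le))
      have h3 : 0 ≤ y T := by linarith [h2.1]
      rw [abs_of_nonneg h3] at h1
      exact h1.le)
    (fun y hy h0 => by
      change y t₀ = -(N + L * (T - t₀)) at h0
      change y T ≤ -(N + L * (T - t₀))
      have h1 := habs y hy (by rw [h0, abs_neg, abs_of_nonneg hR0])
      have h2 := abs_le.1 (hdrift y hy T (right_mem_Icc.2 hT.le))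
      have h3 : y T ≤ 0 := by linarith [h2.2]
      rw [abs_of_nonpos h3] at h1
      linarith)
  -- a closed truncated solution stays in `[-N, N]`
  have hbound : ∀ t ∈ Icc t₀ T, |y t| ≤ N := by
    intro t₁ ht₁
    by_contra hcon
    push Not at hcon
    have hstep : ∀ s t, t₀ ≤ s → s ≤ t → t ≤ T → lyap N (y s) - K ≤ lyap N (y t) := by
      intro s t hs hst ht
      have h1 := hlow _ (hcz y hy) s t hs hst ht
      rw [hW y hy s t hs hst ht] at h1
      linarith
    have hWN : lyap N N ≤ lyap N (y t₁) := by
      rw [← lyap_abs hN0 (y t₁)]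
      exact lyap_mono hN0 hN0 (abs_nonneg (y t₁)) hcon.le
    rw [lyap_eq hN0 le_rfl] at hWN
    have hall : ∀ t ∈ Icc t₀ T, M ≤ |y t| := by
      intro t ht
      have h1 := hstep t₁ T ht₁.1 ht₁.2 le_rfl
      have h2 := hstep t₀ t le_rfl ht.1 ht.2
      rw [hcl] at h2
      by_contra hlt
      push Not at hlt
      have h3 := lyap_mono hN0 (abs_nonneg (y t)) (show (0 : ℝ) ≤ M by linarith) hlt.le
      rw [lyap_abs hN0, lyap_eq (by linarith) hMN] at h3
      linarith
    have h4 := hW2 y hy hall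
    rw [hcl] at h4
    exact lt_irrefl _ h4
  refine ⟨y, fun t ht => ?_, hcl⟩
  have h := hy t ht
  simp only [hF, clampN_of_abs_le (hbound t ht)] at h
  exact h
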